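/- arXiv:1705.10024 — 2 statements merged into one kernel-verified Lean document; each statement's English description precedes it below -/
import Mathlib

section
/- Let G be a multi r-edge-colored complete graph (transitive coloring with colors from {1,...,r}) in which every edge has at least t different colors, where r/4 < t ≤ r − 1. Then V(G) can be covered by at most r − t monochromatic components. -/
/-- `c u v` plays the role of the set of coordinates in which `u` and `v` agree; any two
points agree in at least `t` coordinates. -/
structure IsAgreement {V : Type*} {r : ℕ} (t : ℕ) (c : V → V → Finset (Fin r)) : Prop where
  symm : ∀ {u v : V} {i : Fin r}, i ∈ c u v → i ∈ c v u
  trans : ∀ {u v w : V} {i : Fin r}, i ∈ c u v → i ∈ c v w → i ∈ c u w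
  le_card : ∀ u v : V, t ≤ (c u v).card

/-- No `r - t` components cover all points. -/
def NoSmallCover {V : Type*} {r : ℕ} (t : ℕ) (c : V → V → Finset (Fin r)) : Prop :=
  ∀ S : Finset (V × Fin r), S.card ≤ r - t → ∃ w, ∀ p ∈ S, p.2 ∉ c w p.1

namespace IsAgreement

variable {V : Type*} {r t : ℕ} {c : V → V → Finset (Fin r)}

lemma exists_eq_of_card_eq (hc : IsAgreement t c) (hno : NoSmallCover t c) (v : V)
    {A : Finset (Fin r)} (hA : A.card = t) : ∃ u, c u v = A := by
  obtain ⟨w, hw⟩ := hno ({v} ×ˢ Aᶜ) (by simp [Finset.card_compl, hA])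
  refine ⟨w, Finset.eq_of_subset_of_card_le (fun i hi => ?_) (hA ▸ hc.le_card w v)⟩
  by_contra h
  exact hw (v, i) (by simp [h]) hi

lemma eq_univ_or_card_eq (hc : IsAgreement t c) (hno : NoSmallCover t c) (hr : r < 4 * t)
    (u v : V) : c u v = Finset.univ ∨ ((c u v).card = t ∧ r = 4 * t - 1) := by
  classical
  by_contra! h
  obtain ⟨hne, hcard⟩ := h
  have hs := hc.le_card u v
  have hsr : (c u v).card < r := by
    simpa using Finset.card_lt_card (Finset.ssubset_univ_iff.2 hne)
  by_cases hle : (c u v).card ≤ r - t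
  · obtain ⟨D, hD, hDcard⟩ := Finset.exists_subset_card_eq (s := (c u v)ᶜ)
      (n := (r - t - (c u v).card) / 2) (by rw [Finset.card_compl, Fintype.card_fin]; omega)
    obtain ⟨w, hw⟩ := hno ({v} ×ˢ (c u v ∪ D) ∪ {u} ×ˢ D) (by
      refine (Finset.card_union_le _ _).trans ?_
      have := Finset.card_union_le (c u v) D
      simp only [Finset.card_product, Finset.card_singleton, one_mul]
      omega)
    have hwv : ∀ i ∈ c u v ∪ D, i ∉ c w v := fun i hi => hw (v, i) (by
      simp only [Finset.mem_union, Finset.mem_product, Finset.mem_singleton] at hi ⊢; tauto)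
    have hwu : ∀ i ∈ D, i ∉ c w u := fun i hi => hw (u, i) (by simp_all)
    have hdisj : Disjoint (c w v) (c w u) := by
      refine Finset.disjoint_left.2 fun i hv hu => ?_
      exact hwv i (Finset.mem_union_left _ (hc.trans (hc.symm hu) hv)) hv
    have hsub : c w v ∪ c w u ⊆ (c u v ∪ D)ᶜ := by
      intro i hi
      rw [Finset.mem_compl]
      intro hi'
      rcases Finset.mem_union.1 hi with h | h
      · exact hwv i hi' h
      · rcases Finset.mem_union.1 hi' with h' | h'
        · exact hwv i hi' (hc.trans h h')
        · exact hwu i h' h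
    have h1 := Finset.card_le_card hsub
    rw [Finset.card_union_of_disjoint hdisj, Finset.card_compl, Fintype.card_fin,
      Finset.card_union_of_disjoint
        (Finset.disjoint_left.2 fun i hi hi' => Finset.mem_compl.1 (hD hi') hi)] at h1
    have := hc.le_card w v
    have := hc.le_card w u
    omega
  · obtain ⟨A, hA, hAcard⟩ := Finset.exists_subset_card_eq (s := c u v)
      (n := r - t) (by omega)
    obtain ⟨w, hw⟩ := hno ({v} ×ˢ A) (by simp [hAcard])
    have hwv : ∀ i ∈ A, i ∉ c w v := fun i hi => hw (v, i) (by simp_all)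
    have hcompl : Aᶜ.card ≤ t := by rw [Finset.card_compl, Fintype.card_fin]; omega
    have hv : c w v = Aᶜ := Finset.eq_of_subset_of_card_le
      (fun i hi => Finset.mem_compl.2 fun h => hwv i h hi) (hcompl.trans (hc.le_card w v))
    have hu : c w u = Aᶜ := Finset.eq_of_subset_of_card_le
      (fun i hi => Finset.mem_compl.2 fun h => hwv i h (hc.trans hi (hA h)))
      (hcompl.trans (hc.le_card w u))
    refine hne (Finset.eq_univ_iff_forall.2 fun i => ?_)
    by_cases hi : i ∈ A
    · exact hA hi
    · have hi' := Finset.mem_compl.2 hi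
      exact hc.trans (hc.symm (hu ▸ hi' : i ∈ c w u)) (hv ▸ hi')

lemma not_noSmallCover_of_two_le (hc : IsAgreement t c) (v : V) (ht : 2 ≤ t)
    (hr : r = 4 * t - 1) : ¬ NoSmallCover t c := by
  classical
  intro hno
  obtain ⟨L, -, hL⟩ := Finset.exists_subset_card_eq (s := (Finset.univ : Finset (Fin r)))
    (n := t + 1) (by rw [Finset.card_univ, Fintype.card_fin]; omega)
  obtain ⟨x, hx⟩ : L.Nonempty := Finset.card_pos.1 (by omega)
  obtain ⟨y, hy⟩ : (L.erase x).Nonempty :=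
    Finset.card_pos.1 (by rw [Finset.card_erase_of_mem hx]; omega)
  obtain ⟨hyx, hyL⟩ := Finset.mem_erase.1 hy
  set K := (L.erase x).erase y with hK
  have hKcard : K.card = t - 1 := by
    rw [hK, Finset.card_erase_of_mem hy, Finset.card_erase_of_mem hx]; omega
  obtain ⟨u, hu⟩ := hc.exists_eq_of_card_eq hno v (A := L.erase y)
    (by rw [Finset.card_erase_of_mem hyL]; omega)
  obtain ⟨w, hw⟩ := hc.exists_eq_of_card_eq hno v (A := L.erase x)
    (by rw [Finset.card_erase_of_mem hx]; omega)
  have hxu : x ∈ c u v := by rw [hu]; simp [hx, hyx.symm]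
  have hxw : x ∉ c w v := by rw [hw]; simp
  have hxuw : x ∉ c u w := fun h => hxw (hc.trans (hc.symm h) hxu)
  have huw : (c u w).card = t := by
    rcases hc.eq_univ_or_card_eq hno (by omega) u w with h | h
    · simp [h] at hxuw
    · exact h.1
  have hKuv : ∀ i ∈ K, i ∈ c u v := by intro i hi; rw [hu]; simp_all
  have hKwv : ∀ i ∈ K, i ∈ c w v := by intro i hi; rw [hw]; simp_all
  have hKuw : K ⊆ c u w := fun i hi => hc.trans (hKuv i hi) (hc.symm (hKwv i hi))
  obtain ⟨z, hz⟩ := hno ({v} ×ˢ L ∪ {u} ×ˢ (c u w \ K) ∪ {(w, x)}) (by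
    refine (Finset.card_union_le _ _).trans ?_
    have := Finset.card_union_le ({v} ×ˢ L) ({u} ×ˢ (c u w \ K))
    have := Finset.card_sdiff_of_subset hKuw
    simp only [Finset.card_product, Finset.card_singleton, one_mul] at *
    omega)
  have hzv : ∀ i ∈ L, i ∉ c z v := fun i hi => hz (v, i) (by simp_all)
  have hzu : ∀ i ∈ c u w, i ∉ c z u := by
    intro i hi h
    by_cases hiK : i ∈ K
    · exact hzv i (by simp_all) (hc.trans h (hKuv i hiK))
    · exact hz (u, i) (by simp [hi, hiK]) h
  have hzw : x ∉ c z w := hz (w, x) (by simp)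
  have h12 : Disjoint (c z v) (c z u) := by
    refine Finset.disjoint_left.2 fun i h1 h2 => hzv i ?_ h1
    have := hc.trans (hc.symm h2) h1
    rw [hu] at this
    exact Finset.mem_of_mem_erase this
  have h13 : Disjoint (c z v) (c z w) := by
    refine Finset.disjoint_left.2 fun i h1 h2 => hzv i ?_ h1
    have := hc.trans (hc.symm h2) h1
    rw [hw] at this
    exact Finset.mem_of_mem_erase this
  have h23 : Disjoint (c z u) (c z w) :=
    Finset.disjoint_left.2 fun i h1 h2 => hzu i (hc.trans (hc.symm h1) h2) h1
  have hsub : c z v ∪ c z u ∪ c z w ⊆ (L.erase y)ᶜ := by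
    intro i hi
    rw [Finset.mem_compl]
    intro hiy
    have hiL := Finset.mem_of_mem_erase hiy
    rcases Finset.mem_union.1 hi with h | h
    · rcases Finset.mem_union.1 h with h | h
      · exact hzv i hiL h
      · exact hzv i hiL (hc.trans h (by rw [hu]; exact hiy))
    · by_cases hix : i = x
      · exact hzw (hix ▸ h)
      · exact hzv i hiL (hc.trans h (by rw [hw]; simp [hix, hiL]))
  have hle := Finset.card_le_card hsub
  rw [Finset.card_union_of_disjoint (Finset.disjoint_union_left.2 ⟨h13, h23⟩),
    Finset.card_union_of_disjoint h12, Finset.card_compl, Fintype.card_fin,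
    Finset.card_erase_of_mem hyL] at hle
  have := hc.le_card z v
  have := hc.le_card z u
  have := hc.le_card z w
  omega

lemma not_noSmallCover_three {c : V → V → Finset (Fin 3)} (hc : IsAgreement 1 c) (v : V) :
    ¬ NoSmallCover 1 c := by
  classical
  intro hno
  obtain ⟨p, hp⟩ := hc.exists_eq_of_card_eq hno v (A := {1}) rfl
  obtain ⟨q, hq⟩ := hc.exists_eq_of_card_eq hno v (A := {2}) rfl
  have hne (u w : V) : ∃ i, i ∈ c u w := Finset.card_pos.1 (hc.le_card u w)
  have hp' (i : Fin 3) : i ∈ c p v ↔ i = 1 := by simp [hp]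
  have hq' (i : Fin 3) : i ∈ c q v ↔ i = 2 := by simp [hq]
  have hpq : (0 : Fin 3) ∈ c p q := by
    obtain ⟨i, hi⟩ := hne p q
    have h1 : i ≠ 1 := fun h => by
      have := (hq' i).1 (hc.trans (hc.symm hi) ((hp' i).2 h))
      simp [h] at this
    have h2 : i ≠ 2 := fun h => by
      have := (hp' i).1 (hc.trans hi ((hq' i).2 h))
      simp [h] at this
    fin_cases i <;> simp_all
  obtain ⟨w, hw⟩ := hno {(v, 0), (p, 0)} Finset.card_le_two
  have hwv : (0 : Fin 3) ∉ c w v := hw (v, 0) (by simp)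
  have hwp : (0 : Fin 3) ∉ c w p := hw (p, 0) (by simp)
  have hwq : (0 : Fin 3) ∉ c w q := fun h => hwp (hc.trans h (hc.symm hpq))
  have h1 : (1 : Fin 3) ∈ c w v := by
    obtain ⟨i, hi⟩ := hne w p
    have hi0 : i ≠ 0 := fun h => hwp (h ▸ hi)
    by_cases hi1 : i = 1
    · exact hi1 ▸ hc.trans hi ((hp' i).2 hi1)
    · have hi2 : i = 2 := by omega
      subst hi2
      obtain ⟨j, hj⟩ := hne w v
      have hj0 : j ≠ 0 := fun h => hwv (h ▸ hj)
      by_cases hj1 : j = 1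
      · exact hj1 ▸ hj
      · have hj2 : j = 2 := by omega
        subst hj2
        have := (hp' 2).1 (hc.trans (hc.symm hi) hj)
        simp at this
  have h2 : (2 : Fin 3) ∈ c w v := by
    obtain ⟨i, hi⟩ := hne w q
    have hi0 : i ≠ 0 := fun h => hwq (h ▸ hi)
    by_cases hi2 : i = 2
    · exact hi2 ▸ hc.trans hi ((hq' i).2 hi2)
    · have hi1 : i = 1 := by omega
      subst hi1
      have := (hq' 1).1 (hc.trans (hc.symm hi) h1)
      simp at this
  rcases hc.eq_univ_or_card_eq hno (by norm_num) w v with h | ⟨h, -⟩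
  · simp [h] at hwv
  · have := Finset.card_le_one.1 h.le 1 h1 2 h2
    simp at this

lemma not_noSmallCover (hc : IsAgreement t c) (hr : r < 4 * t) (htr : t < r) :
    ¬ NoSmallCover t c := by
  intro hno
  obtain ⟨v, -⟩ := hno ∅ (by simp)
  obtain ⟨A, -, hA⟩ := Finset.exists_subset_card_eq (s := (Finset.univ : Finset (Fin r)))
    (n := t) (by rw [Finset.card_univ, Fintype.card_fin]; omega)
  obtain ⟨u, hu⟩ := hc.exists_eq_of_card_eq hno v hA
  have hr' : r = 4 * t - 1 := by
    rcases hc.eq_univ_or_card_eq hno hr u v with h | h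
    · rw [← hu, h, Finset.card_univ, Fintype.card_fin] at hA
      omega
    · exact h.2
  by_cases ht : 2 ≤ t
  · exact hc.not_noSmallCover_of_two_le v ht hr' hno
  · obtain rfl : t = 1 := by omega
    obtain rfl : r = 3 := by omega
    exact hc.not_noSmallCover_three v hno

end IsAgreement

/-- In a multi r-edge-colored complete graph (transitive coloring)
where every edge has at least t colors with r/4 < t ≤ r − 1, V(G) can be covered
by at most r − t monochromatic components. -/
theorem stmt_1 {V : Type*} [Fintype V] [DecidableEq V] (r t : ℕ)
    (col : V → V → Finset (Fin r))
    (hsymm : ∀ u v : V, col u v = col v u)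
    (htrans : ∀ u v w : V, ∀ i : Fin r,
      i ∈ col u v → i ∈ col v w → u ≠ w → i ∈ col u w)
    (hcard : ∀ u v : V, u ≠ v → t ≤ (col u v).card)
    (hlow : r < 4 * t) (hhigh : t ≤ r - 1) :
    ∃ S : Finset (V × Fin r), S.card ≤ r - t ∧
      ∀ u : V, ∃ p ∈ S, u = p.1 ∨ p.2 ∈ col u p.1 := by
  have hc : IsAgreement t (fun u v => if u = v then Finset.univ else col u v) := by
    refine ⟨?_, ?_, ?_⟩
    · intro u v i h
      by_cases huv : u = v
      · simp [huv]
      · simpa [huv, Ne.symm huv, hsymm v u] using h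
    · intro u v w i h h'
      by_cases huw : u = w
      · simp [huw]
      by_cases huv : u = v
      · subst huv; exact h'
      by_cases hvw : v = w
      · subst hvw; exact h
      simp only [huv, hvw, huw, if_false] at h h' ⊢
      exact htrans u v w i h h' huw
    · intro u v
      by_cases huv : u = v
      · simp only [huv, if_true, Finset.card_univ, Fintype.card_fin]; omega
      · simpa [huv] using hcard u v huv
  by_contra! hno
  refine hc.not_noSmallCover hlow (by omega) fun S hS => ?_
  obtain ⟨w, hw⟩ := hno S hS
  refine ⟨w, fun p hp => ?_⟩
  simpa [(hw p hp).1] using (hw p hp).2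
end

section
/- Let H be an r-uniform r-partite hypergraph that is t-intersecting (every two hyperedges share at least t vertices), with r/4 < t ≤ r − 1. Then the vertex cover number of H satisfies τ(H) ≤ r − t. -/
open Finset

/-- The set of coordinates in which two functions agree. -/
def agreeSet {ι W : Type*} [Fintype ι] [DecidableEq W] (x y : ι → W) : Finset ι :=
  univ.filter fun i => x i = y i

/-- Every choice of at most `k` values, taken from three members of `F`, is avoided by a member of
`F`. -/
def AvoidsSmall {ι W : Type*} (F : Set (ι → W)) (k : ℕ) : Prop :=
  ∀ e ∈ F, ∀ f ∈ F, ∀ g ∈ F, ∀ A B C : Finset ι, #A + #B + #C ≤ k →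
    ∃ h ∈ F, (∀ i ∈ A, h i ≠ e i) ∧ (∀ i ∈ B, h i ≠ f i) ∧ ∀ i ∈ C, h i ≠ g i

section Agree

variable {ι W : Type*} [Fintype ι] [DecidableEq W]

@[simp] lemma mem_agreeSet {x y : ι → W} {i : ι} : i ∈ agreeSet x y ↔ x i = y i := by
  simp [agreeSet]

lemma card_agreeSet_lt {x y : ι → W} (hxy : x ≠ y) : #(agreeSet x y) < Fintype.card ι := by
  obtain ⟨i, hi⟩ := Function.ne_iff.1 hxy
  exact card_lt_univ_of_notMem (x := i) (by simpa using hi)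

variable [DecidableEq ι]

/-- If no small cover exists, then `r = 4 * t - 1` and distinct members agree in exactly `t`
coordinates. -/
lemma card_agreeSet_eq {F : Set (ι → W)} {t : ℕ}
    (hint : ∀ x ∈ F, ∀ y ∈ F, t ≤ #(agreeSet x y))
    (hlow : Fintype.card ι < 4 * t) (hcov : AvoidsSmall F (Fintype.card ι - t))
    {e f : ι → W} (he : e ∈ F) (hf : f ∈ F) (hef : e ≠ f) :
    #(agreeSet e f) = t ∧ Fintype.card ι + 1 = 4 * t := by
  have hs := card_agreeSet_lt hef
  have hts := hint e he f hf
  set S := agreeSet e f with hS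
  have hcompl : #Sᶜ = Fintype.card ι - #S := card_compl S
  rcases le_or_gt (Fintype.card ι - t) #S with hle | hgt
  · obtain ⟨K, hKS, hK⟩ := exists_subset_card_eq hle
    obtain ⟨h, hh, h1, -, -⟩ := hcov e he f hf f hf K ∅ ∅ (by simp [hK])
    have hE := hint h hh e he
    have hF := hint h hh f hf
    have hunion : #(agreeSet h e ∪ agreeSet h f) ≤ #Kᶜ := by
      refine card_le_card fun i hi => mem_compl.2 fun hiK => h1 i hiK ?_
      have h2 : e i = f i := by simpa [hS] using hKS hiK
      rcases mem_union.1 hi with hi | hi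
      · simpa using hi
      · rw [h2]; simpa using hi
    have hinter : #(agreeSet h e ∩ agreeSet h f) ≤ #(S \ K) := by
      refine card_le_card fun i hi => ?_
      simp only [mem_inter, mem_agreeSet] at hi
      exact mem_sdiff.2 ⟨by simp [hS, ← hi.1, ← hi.2], fun hiK => h1 i hiK hi.1⟩
    have h3 := card_union_add_card_inter (agreeSet h e) (agreeSet h f)
    have h4 : #(S \ K) = #S - #K := card_sdiff_of_subset hKS
    have h5 : #Kᶜ = Fintype.card ι - #K := card_compl K
    omega
  · obtain ⟨B, hBS, hB⟩ := exists_subset_card_eq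
      (s := Sᶜ) (n := (Fintype.card ι - t - #S) / 2) (by omega)
    have hdisj : Disjoint S B := by
      rw [disjoint_left]; intro i hi hiB
      exact mem_compl.1 (hBS hiB) hi
    have hcard := card_union_of_disjoint hdisj
    obtain ⟨h, hh, h1, h2, -⟩ := hcov e he f hf f hf (S ∪ B) B ∅ (by rw [card_empty]; omega)
    have hE := hint h hh e he
    have hF := hint h hh f hf
    have hunion : #(agreeSet h e ∪ agreeSet h f) ≤ #(S ∪ B)ᶜ := by
      refine card_le_card fun i hi => mem_compl.2 fun hiK => ?_
      rcases mem_union.1 hi with hi | hi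
      · exact h1 i hiK (by simpa using hi)
      · rcases mem_union.1 hiK with hiS | hiB
        · have h3 : e i = f i := by simpa [hS] using hiS
          exact h1 i hiK (by rw [h3]; simpa using hi)
        · exact h2 i hiB (by simpa using hi)
    have hinter : Disjoint (agreeSet h e) (agreeSet h f) := by
      rw [disjoint_left]; intro i hi hi'
      rw [mem_agreeSet] at hi hi'
      exact h1 i (mem_union_left _ (by simp [hS, ← hi, ← hi'])) hi
    have h3 := card_union_of_disjoint hinter
    have h5 : #(S ∪ B)ᶜ = Fintype.card ι - #(S ∪ B) := card_compl _
    omega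

/-- Three members whose pairwise agreement sets almost coincide yield a small cover. -/
lemma false_of_three {F : Set (ι → W)} {t c d : ℕ}
    (hint : ∀ x ∈ F, ∀ y ∈ F, t ≤ #(agreeSet x y))
    (hr : Fintype.card ι + 1 = 4 * t) (hcov : AvoidsSmall F (Fintype.card ι - t))
    {e f g : ι → W} (he : e ∈ F) (hf : f ∈ F) (hg : g ∈ F)
    (hef : #(agreeSet e f) = t) (heg : #(agreeSet e g) = t) (hfg : #(agreeSet f g) = t)
    (hc : #(agreeSet e f ∩ agreeSet e g) = c) (hcd : c + d = t) (hsmall : c + 4 * d + 1 ≤ 3 * t) :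
    False := by
  set S := agreeSet e f with hS
  set U := agreeSet e g with hU
  have hSU := card_sdiff_add_card_inter S U
  have hUS := card_sdiff_add_card_inter U S
  rw [inter_comm] at hUS
  have hun := card_union_add_card_inter S U
  have hC : S ∩ U ⊆ agreeSet f g := by
    intro i hi
    simp only [hS, hU, mem_inter, mem_agreeSet] at hi
    simp [← hi.1, ← hi.2]
  have hW : #(agreeSet f g \ (S ∩ U)) = #(agreeSet f g) - #(S ∩ U) := card_sdiff_of_subset hC
  obtain ⟨h, hh, h1, h2, h3⟩ := hcov e he f hf g hg (S ∪ U) (U \ S) (S \ U) (by omega)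
  have hE := hint h hh e he
  have hF := hint h hh f hf
  have hG := hint h hh g hg
  have hXY : Disjoint (agreeSet h e) (agreeSet h f ∪ agreeSet h g) := by
    rw [disjoint_left]; intro i hi hi'
    simp only [mem_union, mem_agreeSet] at hi hi'
    refine h1 i (mem_union.2 ?_) hi
    simp only [hS, hU, mem_agreeSet, ← hi]
    exact hi'
  have hYZ : #(agreeSet h f ∩ agreeSet h g) ≤ #(agreeSet f g \ (S ∩ U)) := by
    refine card_le_card fun i hi => ?_
    simp only [mem_inter, mem_agreeSet] at hi
    refine mem_sdiff.2 ⟨by simp [← hi.1, ← hi.2], fun hiC => ?_⟩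
    have hiS := (mem_inter.1 hiC).1
    have h4 : e i = f i := by simpa [hS] using hiS
    exact h1 i (mem_union_left _ hiS) (by rw [h4, hi.1])
  have hunion : #(agreeSet h e ∪ (agreeSet h f ∪ agreeSet h g)) ≤ #(S ∪ U)ᶜ := by
    refine card_le_card fun i hi => mem_compl.2 fun hiK => ?_
    have h4 := h1 i hiK
    have h5 := h2 i
    have h6 := h3 i
    simp only [hS, hU, mem_union, mem_sdiff, mem_agreeSet] at *
    grind
  have h7 := card_union_of_disjoint hXY
  have h8 := card_union_add_card_inter (agreeSet h f) (agreeSet h g)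
  have h9 : #(S ∪ U)ᶜ = Fintype.card ι - #(S ∪ U) := card_compl _
  omega

/-- A family of pairwise `t`-agreeing functions has a small cover when `r < 4 * t`. -/
theorem not_avoidsSmall {F : Set (ι → W)} {t : ℕ} (hne : F.Nonempty)
    (hint : ∀ x ∈ F, ∀ y ∈ F, t ≤ #(agreeSet x y))
    (hlow : Fintype.card ι < 4 * t) (hhigh : t < Fintype.card ι) :
    ¬ AvoidsSmall F (Fintype.card ι - t) := by
  intro hcov
  obtain ⟨e, he⟩ := hne
  obtain ⟨i₀⟩ : Nonempty ι := Fintype.card_pos_iff.1 (by omega)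
  obtain ⟨f, hf, hf1, -, -⟩ := hcov e he e he e he {i₀} ∅ ∅ (by simp; omega)
  have hef : e ≠ f := fun h => hf1 i₀ (by simp) (by rw [h])
  obtain ⟨hS, hr⟩ := card_agreeSet_eq hint hlow hcov he hf hef
  set S := agreeSet e f with hSdef
  have hR : #Sᶜ = Fintype.card ι - #S := card_compl _
  obtain ⟨z, hz, b, hb, hzb⟩ := one_lt_card.1 (show 1 < #Sᶜ by omega)
  have hA := card_erase_of_mem hz
  obtain ⟨g, hg, hg1, hg2, -⟩ := hcov e he f hf f hf (Sᶜ.erase z) {b} ∅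
    (by rw [card_empty, card_singleton]; omega)
  have heg : e ≠ g := fun h => hg1 b (mem_erase.2 ⟨hzb.symm, hb⟩) (by rw [h])
  have hfg : f ≠ g := fun h => hg2 b (by simp) (by rw [h])
  obtain ⟨hU, -⟩ := card_agreeSet_eq hint hlow hcov he hg heg
  obtain ⟨hW, -⟩ := card_agreeSet_eq hint hlow hcov hf hg hfg
  have hcS : #(S ∩ agreeSet e g) ≤ #S := card_le_card inter_subset_left
  have hUsub : agreeSet e g ⊆ insert z (S ∩ agreeSet e g) := by
    intro i hi
    by_contra hcon
    simp only [mem_insert, mem_inter, not_or, not_and] at hcon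
    refine hg1 i (mem_erase.2 ⟨hcon.1, mem_compl.2 fun hiS => hcon.2 hiS hi⟩) ?_
    exact (mem_agreeSet.1 hi).symm
  have hcU := (card_le_card hUsub).trans (card_insert_le _ _)
  refine false_of_three (c := #(S ∩ agreeSet e g)) (d := t - #(S ∩ agreeSet e g)) hint hr hcov he hf hg hS hU
    hW rfl (by omega) ?_
  by_contra hcon
  have ht : t = 1 := by omega
  have hc0 : #(S ∩ agreeSet e g) = 0 := by omega
  have hzU : z ∈ agreeSet e g := by
    by_contra hzn
    rw [card_eq_zero.1 hc0] at hUsub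
    obtain ⟨j, hj⟩ := card_pos.1 (show 0 < #(agreeSet e g) by omega)
    have := mem_singleton.1 (hUsub hj)
    exact hzn (this ▸ hj)
  obtain ⟨w, hw⟩ := card_pos.1 (show 0 < #(agreeSet f g) by omega)
  have hwS : w ∈ Sᶜ := by
    refine mem_compl.2 fun hwS => ?_
    have hwC : w ∈ S ∩ agreeSet e g := by
      refine mem_inter.2 ⟨hwS, ?_⟩
      rw [hSdef, mem_agreeSet] at hwS
      rw [mem_agreeSet] at hw ⊢
      rw [hwS, hw]
    rw [card_eq_zero.1 hc0] at hwC
    simp at hwC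
  have hwz : w ≠ z := by
    rintro rfl
    refine mem_compl.1 hz ?_
    rw [mem_agreeSet] at hw hzU
    rw [hSdef, mem_agreeSet, hw, hzU]
  have hwb : w ≠ b := by
    rintro rfl
    exact hg2 w (by simp) (mem_agreeSet.1 hw).symm
  have hthree : 2 < #Sᶜ := two_lt_card.2 ⟨z, hz, b, hb, w, hwS, hzb, hwz.symm, hwb.symm⟩
  omega

end Agree

/-- An r-uniform r-partite t-intersecting hypergraph with
r/4 < t ≤ r − 1 satisfies τ(H) ≤ r − t. -/
theorem stmt_2 {V : Type*} [DecidableEq V] (r t : ℕ)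
    (H : Finset (Finset V)) (P : V → Fin r)
    (hpart : ∀ e ∈ H, ∀ i : Fin r, (e.filter fun v => P v = i).card = 1)
    (hint : ∀ e ∈ H, ∀ f ∈ H, t ≤ (e ∩ f).card)
    (hlow : r < 4 * t) (hhigh : t ≤ r - 1) :
    ∃ T : Finset V, T.card ≤ r - t ∧ ∀ e ∈ H, ∃ v ∈ T, v ∈ e := by
  by_contra! hcon
  let F : Set (Fin r → V) := {x | (∀ i, P (x i) = i) ∧ univ.image x ∈ H}
  have hlift : ∀ e ∈ H, ∃ x ∈ F, univ.image x = e := by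
    intro e he
    choose x hx using fun i => card_eq_one.1 (hpart e he i)
    have hmem : ∀ i v, (v ∈ e ∧ P v = i) ↔ v = x i := fun i v => by
      simpa only [mem_filter, mem_singleton] using Finset.ext_iff.1 (hx i) v
    have himg : univ.image x = e := by
      ext v
      simp only [mem_image, mem_univ, true_and]
      constructor
      · rintro ⟨i, rfl⟩
        exact ((hmem i _).2 rfl).1
      · exact fun hv => ⟨P v, ((hmem _ v).1 ⟨hv, rfl⟩).symm⟩
    exact ⟨x, ⟨fun i => ((hmem i _).2 rfl).2, by rwa [himg]⟩, himg⟩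
  obtain ⟨e₀, he₀, -⟩ := hcon ∅ (by simp)
  obtain ⟨x₀, hx₀, -⟩ := hlift e₀ he₀
  refine not_avoidsSmall (F := F) (t := t) ⟨x₀, hx₀⟩ ?_ (by simpa using hlow)
    (by rw [Fintype.card_fin]; omega) ?_
  · intro x hx y hy
    refine (hint _ hx.2 _ hy.2).trans ((card_le_card (t := (agreeSet x y).image x) ?_).trans
      card_image_le)
    intro v hv
    simp only [mem_inter, mem_image, mem_univ, true_and] at hv
    obtain ⟨⟨i, rfl⟩, j, hj⟩ := hv
    have hij : j = i := by rw [← hx.1 i, ← hy.1 j, hj]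
    subst hij
    exact mem_image_of_mem _ (mem_agreeSet.2 hj.symm)
  · intro e _ f _ g _ A B C hABC
    rw [Fintype.card_fin] at hABC
    obtain ⟨k, hk, havoid⟩ := hcon (A.image e ∪ B.image f ∪ C.image g) <| by
      have h1 := card_union_le (A.image e ∪ B.image f) (C.image g)
      have h2 := card_union_le (A.image e) (B.image f)
      have h3 := card_image_le (s := A) (f := e)
      have h4 := card_image_le (s := B) (f := f)
      have h5 := card_image_le (s := C) (f := g)
      omega
    obtain ⟨h, hh, rfl⟩ := hlift k hk
    have hne : ∀ i v, v ∈ A.image e ∪ B.image f ∪ C.image g → h i ≠ v := fun i v hv hi =>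
      havoid v hv (hi ▸ mem_image_of_mem h (mem_univ i))
    refine ⟨h, hh, fun i hi => hne i _ ?_, fun i hi => hne i _ ?_, fun i hi => hne i _ ?_⟩
    · exact mem_union_left _ (mem_union_left _ (mem_image_of_mem _ hi))
    · exact mem_union_left _ (mem_union_right _ (mem_image_of_mem _ hi))
    · exact mem_union_right _ (mem_image_of_mem _ hi)
end
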